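/- In the Setup, if an r-chain of points {x_i}_{i=0}^m in X all of the same c*_X-color 𝔠 connects two points x = x₀ and y = x_m of some piece P of X, and none of the projections π_P(x_i) belongs to 𝔠_P, then {π_P(x_i)}_{i=0}^m is an r-chain of points all of c*_X-color 𝔠 connecting x and y inside P. -/

import Mathlib

open Set Metric

section Core

variable {X : Type*} [MetricSpace X]

/-- A geodesic segment parametrized by the interval `[a, b]`:
an isometric embedding of `[a, b]` into `X`. -/
def IsGeodesicSegment (γ : ℝ → X) (a b : ℝ) : Prop :=
  ∀ s ∈ Set.Icc a b, ∀ t ∈ Set.Icc a b, dist (γ s) (γ t) = |s - t|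

/-- A metric space is geodesic if every two points are joined by a geodesic. -/
def GeodesicSpace (X : Type*) [MetricSpace X] : Prop :=
  ∀ x y : X, ∃ γ : ℝ → X, IsGeodesicSegment γ 0 (dist x y) ∧ γ 0 = x ∧ γ (dist x y) = y

/-- A subset is geodesic if every two of its points are joined by a geodesic of `X`
contained in the subset. -/
def IsGeodesicSubset (S : Set X) : Prop :=
  ∀ x ∈ S, ∀ y ∈ S, ∃ γ : ℝ → X, IsGeodesicSegment γ 0 (dist x y) ∧ γ 0 = x ∧
    γ (dist x y) = y ∧ ∀ t ∈ Set.Icc (0 : ℝ) (dist x y), γ t ∈ S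

/-- A (complete geodesic) metric space is tree-graded with respect to a collection `PX`
of closed geodesic subsets (pieces) covering `X` if every two different pieces meet in
at most one point (T₁) and every simple loop (injective continuous image of a circle)
is contained in one piece (T₂''). -/
structure IsTreeGraded (X : Type*) [MetricSpace X] (PX : Set (Set X)) : Prop where
  nonempty : ∀ P ∈ PX, P.Nonempty
  closed : ∀ P ∈ PX, IsClosed P
  geodesicSub : ∀ P ∈ PX, IsGeodesicSubset P
  covers : ∀ x : X, ∃ P ∈ PX, x ∈ P
  t1 : ∀ P ∈ PX, ∀ Q ∈ PX, P ≠ Q → (P ∩ Q).Subsingleton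
  t2 : ∀ loop : AddCircle (1 : ℝ) → X, Continuous loop → Function.Injective loop →
    ∃ P ∈ PX, Set.range loop ⊆ P

end Core
section Chains

variable {Y : Type*}

/-- An `r`-chain from `x` to `y` inside the set `S`, with respect to the distance
function `d`: a finite sequence `x = c 0, c 1, …, c m = y` of points of `S` with
consecutive distances `< r`. -/
def IsDChain (d : Y → Y → ℝ) (r : ℝ) (S : Set Y) (x y : Y) : Prop :=
  ∃ (m : ℕ) (c : ℕ → Y), c 0 = x ∧ c m = y ∧ (∀ i ≤ m, c i ∈ S) ∧
    ∀ i < m, d (c i) (c (i + 1)) < r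

/-- A set is `r`-scale connected if every two of its points are joined by an
`r`-chain contained in it. -/
def DScaleConnected (d : Y → Y → ℝ) (r : ℝ) (S : Set Y) : Prop :=
  ∀ x ∈ S, ∀ y ∈ S, IsDChain d r S x y

/-- `C` is an `r`-scale connected component of `U`: a maximal `r`-scale connected
subset of `U`. -/
def IsDComponent (d : Y → Y → ℝ) (r : ℝ) (U C : Set Y) : Prop :=
  C ⊆ U ∧ DScaleConnected d r C ∧
    ∀ C', C ⊆ C' → C' ⊆ U → DScaleConnected d r C' → C = C'

/-- A set is `M`-bounded: its diameter is at most `M`. -/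
def DBounded (d : Y → Y → ℝ) (M : ℝ) (S : Set Y) : Prop :=
  ∀ x ∈ S, ∀ y ∈ S, d x y ≤ M

/-- A space has dimension `≤ n` at scale `s` of magnitude `M` if there is a cover by
`n + 1` sets such that every `s`-scale connected component of each of them is
`M`-bounded. -/
def DimLeAtScale (d : Y → Y → ℝ) (n : ℕ) (s M : ℝ) : Prop :=
  ∃ U : Fin (n + 1) → Set Y, (∀ y, ∃ i, y ∈ U i) ∧
    ∀ i C, IsDComponent d s (U i) C → DBounded d M C

end Chains
section TreeGradedColoring

variable {X : Type*} [MetricSpace X]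

/-- The `r`-scale connected component `𝔠_P` of `c_P`-color `0` of the piece `P`
containing its base point `x_P = proj P x̂`: the set of points of `P` reachable from
`x_P` by an `r`-chain of points of `P` of `c_P`-color `0`. -/
def pieceComp (r : ℝ) {n : ℕ} (xhat : X) (proj : Set X → X → X)
    (cP : Set X → X → Fin (n + 1)) (P : Set X) : Set X :=
  {y | IsDChain dist r {z | z ∈ P ∧ cP P z = 0} (proj P xhat) y}

/-- `P` is a long piece of the geodesic `γ : [0, L] → X` (from `x̂` to `x = γ L`):
`γ` meets `P` and the exit point `π_P x` does not belong to `𝔠_P`. -/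
def IsLongPiece (PX : Set (Set X)) (r : ℝ) {n : ℕ} (xhat : X)
    (proj : Set X → X → X) (cP : Set X → X → Fin (n + 1))
    (γ : ℝ → X) (L : ℝ) (P : Set X) : Prop :=
  P ∈ PX ∧ (∃ t ∈ Set.Icc 0 L, γ t ∈ P) ∧
    proj P (γ L) ∉ pieceComp r xhat proj cP P

/-- The parameter at which the geodesic `γ : [0, L] → X` enters the piece `P`. -/
noncomputable def pieceStart (γ : ℝ → X) (L : ℝ) (P : Set X) : ℝ :=
  sInf {t | t ∈ Set.Icc 0 L ∧ γ t ∈ P}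

/-- The parameter at which the geodesic `γ : [0, L] → X` exits the piece `P`. -/
noncomputable def pieceEnd (γ : ℝ → X) (L : ℝ) (P : Set X) : ℝ :=
  sSup {t | t ∈ Set.Icc 0 L ∧ γ t ∈ P}

/-- The complement in `γ : [0, L] → X` (in parameter space) of the interiors of all
reduced long pieces of `γ`; its connected components are the subpaths `β₁, …, β_k`. -/
noncomputable def betaSet (PX : Set (Set X)) (r : ℝ) {n : ℕ} (xhat : X)
    (proj : Set X → X → X) (cP : Set X → X → Fin (n + 1))
    (γ : ℝ → X) (L : ℝ) : Set ℝ :=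
  Set.Icc 0 L \
    ⋃ P ∈ {P | IsLongPiece PX r xhat proj cP γ L P},
      Set.Ioo (pieceStart γ L P + r / 2) (pieceEnd γ L P)

/-- The length `|⌊β⌋|` of the initial part of the subpath `β = γ|[a,b]`, where
`⌊β⌋` goes from `β₋ = γ a` to the entry point `β′` of the piece of the induced
tree-graded structure on `β` containing `β₊ = γ b`. -/
noncomputable def floorLen (PX : Set (Set X)) (γ : ℝ → X) (a b : ℝ) : ℝ :=
  sInf {t | t ∈ Set.Icc a b ∧ ∃ P ∈ PX, γ '' Set.Icc t b ⊆ P} - a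

/-- `v` is the value at `x = γ L` of the coloring `c*_X` computed along the geodesic
`γ : [0, L] → X` from `x̂` to `x`:
`v = Σ_P c_P(π_P x) + Σᵢ ⌊ |⌊βᵢ⌋| / (99 f(r)) ⌋ (mod n+1)`,
where the first sum is over the (finitely many) pieces with a nonzero term and
`β₁, …, β_k` are the connected components of the complement in `γ` of the interiors
of the reduced long pieces of `γ`. -/
def ColorValue (PX : Set (Set X)) (r fr : ℝ) {n : ℕ} (xhat : X)
    (proj : Set X → X → X) (cP : Set X → X → Fin (n + 1))
    (γ : ℝ → X) (L : ℝ) (v : Fin (n + 1)) : Prop :=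
  ∃ (Ps : Finset (Set X)) (k : ℕ) (a b : Fin k → ℝ),
    (↑Ps : Set (Set X)) = {P | P ∈ PX ∧ cP P (proj P (γ L)) ≠ 0} ∧
    (∀ i, a i ≤ b i) ∧
    (betaSet PX r xhat proj cP γ L = ⋃ i, Set.Icc (a i) (b i)) ∧
    (∀ i j, i ≠ j → b i < a j ∨ b j < a i) ∧
    (v : ℕ) =
      ((Ps.sum fun P => ((cP P (proj P (γ L)) : ℕ))) +
        (Finset.univ.sum fun i : Fin k =>
          Nat.floor (floorLen PX γ (a i) (b i) / (99 * fr)))) % (n + 1)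

/-- The Setup: `X` is a geodesic metric space, tree-graded with respect to `PX`, pieces
do not contain other pieces; `n` is a positive integer, `r > 0` and `f(r) ≥ r`;
`proj P` is the nearest-point projection onto the piece `P`; `x̂` is a base point and
`x_P = proj P x̂`; `c_P` is a coloring of each piece `P` by `n + 1` colors such that
`r`-components of every nonzero color are `f(r)`-bounded, `r`-components of color `0`
are `8 f(r)`-bounded, and `c_P` vanishes on the closed ball `B(x_P, 2r)`. -/
structure ColoringSetup (X : Type*) [MetricSpace X] (PX : Set (Set X)) (n : ℕ)
    (r fr : ℝ) (xhat : X) (proj : Set X → X → X)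
    (cP : Set X → X → Fin (n + 1)) : Prop where
  geodesic : GeodesicSpace X
  treeGraded : IsTreeGraded X PX
  noPieceContainsPiece : ∀ P ∈ PX, ∀ Q ∈ PX, P ⊆ Q → P = Q
  npos : 0 < n
  rpos : 0 < r
  rlefr : r ≤ fr
  projMem : ∀ P ∈ PX, ∀ x : X, proj P x ∈ P
  projDist : ∀ P ∈ PX, ∀ x : X, dist x (proj P x) = Metric.infDist x P
  ballZero : ∀ P ∈ PX, ∀ y ∈ P, dist y (proj P xhat) ≤ 2 * r → cP P y = 0
  nonzeroBounded : ∀ P ∈ PX, ∀ j : Fin (n + 1), j ≠ 0 →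
    ∀ x y : X, IsDChain dist r {z | z ∈ P ∧ cP P z = j} x y → dist x y ≤ fr
  zeroBounded : ∀ P ∈ PX, ∀ x y : X,
    IsDChain dist r {z | z ∈ P ∧ cP P z = 0} x y → dist x y ≤ 8 * fr

end TreeGradedColoring
/-- Concatenation of `f` up to the parameter `b` with `g` from the parameter `c` on. -/
noncomputable def gluePath {X : Type*} (f g : ℝ → X) (b c : ℝ) : ℝ → X :=
  fun t => if t ≤ b then f t else g (t - b + c)

lemma gluePath_of_le {X : Type*} {f g : ℝ → X} {b c t : ℝ} (h : t ≤ b) :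
    gluePath f g b c t = f t := if_pos h

lemma gluePath_of_lt {X : Type*} {f g : ℝ → X} {b c t : ℝ} (h : b < t) :
    gluePath f g b c t = g (t - b + c) := if_neg (not_le.2 h)

lemma gluePath_continuousOn {X : Type*} [TopologicalSpace X] {f g : ℝ → X} {a b c d : ℝ}
    (hf : ContinuousOn f (Icc a b)) (hg : ContinuousOn g (Icc c d)) (h : f b = g c) :
    ContinuousOn (gluePath f g b c) (Icc a (b + (d - c))) := by
  unfold gluePath
  apply ContinuousOn.if
  · rintro t ⟨-, ht⟩
    have : t ∈ frontier (Iic b) := ht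
    rw [frontier_Iic] at this
    rw [mem_singleton_iff] at this
    subst this
    simpa using h
  · refine hf.mono ?_
    rintro t ⟨ht, ht'⟩
    have : t ∈ closure (Iic b) := ht'
    rw [closure_Iic] at this
    exact ⟨ht.1, this⟩
  · refine hg.comp (by fun_prop) ?_
    rintro t ⟨ht, ht'⟩
    have : t ∈ closure (Ioi b) := by simpa [Ioi] using ht'
    rw [closure_Ioi] at this
    have h1 : b ≤ t := this
    have h2 := ht.2
    constructor <;> linarith

lemma gluePath_injOn {X : Type*} {f g : ℝ → X} {b c : ℝ} {I J S : Set ℝ}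
    (hf : InjOn f I) (hg : InjOn g J) (hfg : ∀ s ∈ I, ∀ t ∈ J, f s ≠ g t)
    (hI : ∀ t ∈ S, t ≤ b → t ∈ I) (hJ : ∀ t ∈ S, b < t → t - b + c ∈ J) :
    InjOn (gluePath f g b c) S := by
  intro s hs t ht hst
  rcases le_or_gt s b with h1 | h1 <;> rcases le_or_gt t b with h2 | h2
  · rw [gluePath_of_le h1, gluePath_of_le h2] at hst
    exact hf (hI s hs h1) (hI t ht h2) hst
  · rw [gluePath_of_le h1, gluePath_of_lt h2] at hst
    exact absurd hst (hfg _ (hI s hs h1) _ (hJ t ht h2))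
  · rw [gluePath_of_lt h1, gluePath_of_le h2] at hst
    exact absurd hst.symm (hfg _ (hI t ht h2) _ (hJ s hs h1))
  · rw [gluePath_of_lt h1, gluePath_of_lt h2] at hst
    have := hg (hJ s hs h1) (hJ t ht h2) hst
    linarith

/-- There is a (possibly degenerate) simple arc from `u` to `v` contained in `S`. -/
def JoinedByArc {X : Type*} [TopologicalSpace X] (S : Set X) (u v : X) : Prop :=
  ∃ (f : ℝ → X) (a b : ℝ), a ≤ b ∧ ContinuousOn f (Icc a b) ∧ InjOn f (Icc a b) ∧
    f a = u ∧ f b = v ∧ ∀ t ∈ Icc a b, f t ∈ S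

lemma JoinedByArc.mono {X : Type*} [TopologicalSpace X] {S T : Set X} {u v : X}
    (h : JoinedByArc S u v) (hST : S ⊆ T) : JoinedByArc T u v := by
  obtain ⟨f, a, b, hab, hc, hi, ha, hb, hS⟩ := h
  exact ⟨f, a, b, hab, hc, hi, ha, hb, fun t ht => hST (hS t ht)⟩

lemma JoinedByArc.symm {X : Type*} [TopologicalSpace X] {S : Set X} {u v : X}
    (h : JoinedByArc S u v) : JoinedByArc S v u := by
  obtain ⟨f, a, b, hab, hc, hi, ha, hb, hS⟩ := h
  have hmaps : ∀ t ∈ Icc (-b) (-a), -t ∈ Icc a b := fun t ht =>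
    ⟨by linarith [ht.2], by linarith [ht.1]⟩
  refine ⟨fun t => f (-t), -b, -a, by linarith, hc.comp (by fun_prop) hmaps, ?_,
    by simpa using hb, by simpa using ha, fun t ht => hS _ (hmaps t ht)⟩
  intro s hs t ht hst
  exact neg_injective (hi (hmaps s hs) (hmaps t ht) hst)

lemma JoinedByArc.trans {X : Type*} [TopologicalSpace X] [T2Space X] {S : Set X} {u v w : X}
    (h₁ : JoinedByArc S u v) (h₂ : JoinedByArc S v w) : JoinedByArc S u w := by
  obtain ⟨f, a, b, hab, hfc, hfi, hfa, hfb, hfS⟩ := h₁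
  obtain ⟨g, c, d, hcd, hgc, hgi, hgc', hgd, hgS⟩ := h₂
  have hG : IsClosed (g '' Icc c d) := (isCompact_Icc.image_of_continuousOn hgc).isClosed
  have hK : IsCompact (Icc a b ∩ f ⁻¹' (g '' Icc c d)) :=
    isCompact_Icc.of_isClosed_subset (hfc.preimage_isClosed_of_isClosed isClosed_Icc hG)
      inter_subset_left
  obtain ⟨s, ⟨hs, t, ht, hts⟩, hmin⟩ := hK.exists_isLeast
    ⟨b, right_mem_Icc.2 hab, c, left_mem_Icc.2 hcd, by rw [hgc', hfb]⟩
  have hsub : Icc a s ⊆ Icc a b := Icc_subset_Icc_right hs.2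
  have hsub' : Icc t d ⊆ Icc c d := Icc_subset_Icc_left ht.1
  refine ⟨gluePath f g s t, a, s + (d - t), by linarith [hs.1, ht.2],
    gluePath_continuousOn (hfc.mono hsub) (hgc.mono hsub') hts.symm,
    gluePath_injOn (I := Icc a s) (J := Ioc t d) (hfi.mono hsub)
      (hgi.mono (Ioc_subset_Icc_self.trans hsub')) ?_ (fun x hx h => ⟨hx.1, h⟩)
      (fun x hx h => ⟨by linarith, by linarith [hx.2]⟩), ?_, ?_, ?_⟩
  · intro x hx y hy hxy
    have hy' : y ∈ Icc c d := hsub' (Ioc_subset_Icc_self hy)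
    have hsx : s ≤ x := hmin ⟨hsub hx, y, hy', hxy.symm⟩
    have : x = s := le_antisymm hx.2 hsx
    subst this
    have := hgi ht hy' (hts.trans hxy)
    linarith [hy.1]
  · rw [gluePath_of_le hs.1, hfa]
  · rcases ht.2.eq_or_lt with h | h
    · rw [gluePath_of_le (by linarith), ← h, sub_self, add_zero, ← hts, h, hgd]
    · rw [gluePath_of_lt (by linarith), ← hgd]
      congr 1
      ring
  · intro x hx
    rcases le_or_gt x s with h | h
    · rw [gluePath_of_le h]
      exact hfS _ (hsub ⟨hx.1, h⟩)
    · rw [gluePath_of_lt h]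
      exact hgS _ (hsub' ⟨by linarith, by linarith [hx.2]⟩)

lemma IsTreeGraded.loop_subset_piece {X : Type*} [MetricSpace X] {PX : Set (Set X)}
    (hT : IsTreeGraded X PX) {h : ℝ → X} {a b : ℝ} (hab : a < b)
    (hc : ContinuousOn h (Icc a b)) (hi : InjOn h (Ico a b)) (hends : h a = h b) :
    ∃ P ∈ PX, h '' Icc a b ⊆ P := by
  set k : ℝ → X := fun t => h (a + t * (b - a)) with hk
  have hpos : 0 < b - a := sub_pos.2 hab
  have : Fact ((0 : ℝ) < 1) := ⟨one_pos⟩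
  have hcont : Continuous (AddCircle.liftIco (1 : ℝ) 0 k) := by
    apply AddCircle.liftIco_zero_continuous
    · simp [hk, hends]
    · refine hc.comp (by fun_prop) fun t ht => ⟨?_, ?_⟩
      · nlinarith [ht.1]
      · nlinarith [ht.2]
  have hsurj : ∀ x : AddCircle (1 : ℝ), ∃ t ∈ Ico (0 : ℝ) 1, (t : AddCircle (1 : ℝ)) = x := by
    intro x
    have := (AddCircle.coe_image_Ico_eq (1 : ℝ) 0)
    have hx : x ∈ ((↑) : ℝ → AddCircle (1 : ℝ)) '' Ico 0 (0 + 1) := by rw [this]; trivial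
    simpa using hx
  have hinj : Function.Injective (AddCircle.liftIco (1 : ℝ) 0 k) := by
    intro x y hxy
    obtain ⟨s, hs, rfl⟩ := hsurj x
    obtain ⟨t, ht, rfl⟩ := hsurj y
    rw [AddCircle.liftIco_zero_coe_apply hs, AddCircle.liftIco_zero_coe_apply ht] at hxy
    have := hi (x₁ := a + s * (b - a)) (x₂ := a + t * (b - a))
      ⟨by nlinarith [hs.1], by nlinarith [hs.2]⟩ ⟨by nlinarith [ht.1], by nlinarith [ht.2]⟩ hxy
    have hst : s = t := mul_right_cancel₀ hpos.ne' (by linarith)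
    rw [hst]
  obtain ⟨P, hP, hsub⟩ := hT.t2 _ hcont hinj
  have hIco : ∀ t ∈ Ico a b, h t ∈ P := by
    intro t ht
    refine hsub ⟨(((t - a) / (b - a) : ℝ) : AddCircle (1 : ℝ)), ?_⟩
    rw [AddCircle.liftIco_zero_coe_apply]
    · simp only [hk]
      congr 1
      field_simp
      ring
    · exact ⟨div_nonneg (by linarith [ht.1]) hpos.le, by
        rw [div_lt_one hpos]; linarith [ht.2]⟩
  refine ⟨P, hP, ?_⟩
  rintro _ ⟨t, ht, rfl⟩
  rcases ht.2.eq_or_lt with rfl | h'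
  · rw [← hends]
    exact hIco a ⟨le_rfl, hab⟩
  · exact hIco t ⟨ht.1, h'⟩

lemma IsGeodesicSegment.continuousOn {X : Type*} [MetricSpace X] {γ : ℝ → X} {a b : ℝ}
    (hγ : IsGeodesicSegment γ a b) : ContinuousOn γ (Icc a b) := by
  have : LipschitzOnWith 1 γ (Icc a b) := LipschitzOnWith.of_dist_le_mul fun x hx y hy => by
    rw [hγ x hx y hy, Real.dist_eq]
    simp
  exact this.continuousOn

lemma IsGeodesicSegment.injOn {X : Type*} [MetricSpace X] {γ : ℝ → X} {a b : ℝ}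
    (hγ : IsGeodesicSegment γ a b) : InjOn γ (Icc a b) := by
  intro s hs t ht hst
  have := hγ s hs t ht
  rw [hst, dist_self] at this
  exact sub_eq_zero.1 (abs_eq_zero.1 this.symm)

lemma IsGeodesicSegment.mono {X : Type*} [MetricSpace X] {γ : ℝ → X} {a b a' b' : ℝ}
    (hγ : IsGeodesicSegment γ a b) (ha : a ≤ a') (hb : b' ≤ b) :
    IsGeodesicSegment γ a' b' :=
  fun s hs t ht => hγ s ⟨ha.trans hs.1, hs.2.trans hb⟩ t ⟨ha.trans ht.1, ht.2.trans hb⟩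

lemma IsGeodesicSegment.dist_eq {X : Type*} [MetricSpace X] {γ : ℝ → X} {a b s t : ℝ}
    (hγ : IsGeodesicSegment γ a b) (ha : a ≤ s) (hst : s ≤ t) (hb : t ≤ b) :
    dist (γ s) (γ t) = t - s := by
  rw [hγ s ⟨ha, hst.trans hb⟩ t ⟨ha.trans hst, hb⟩, abs_sub_comm, abs_of_nonneg (by linarith)]

lemma IsGeodesicSegment.reverse {X : Type*} [MetricSpace X] {γ : ℝ → X} {a b : ℝ}
    (hγ : IsGeodesicSegment γ a b) : IsGeodesicSegment (fun t => γ (-t)) (-b) (-a) := by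
  intro s hs t ht
  have := hγ (-s) ⟨by linarith [hs.2], by linarith [hs.1]⟩ (-t)
    ⟨by linarith [ht.2], by linarith [ht.1]⟩
  rw [this, abs_sub_comm]
  congr 1
  ring

lemma IsGeodesicSegment.joinedByArc {X : Type*} [MetricSpace X] {γ : ℝ → X} {a b : ℝ}
    (hγ : IsGeodesicSegment γ a b) (hab : a ≤ b) {S : Set X} (hS : ∀ t ∈ Icc a b, γ t ∈ S) :
    JoinedByArc S (γ a) (γ b) :=
  ⟨γ, a, b, hab, hγ.continuousOn, hγ.injOn, rfl, rfl, hS⟩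

/-- A simple arc with endpoints in a piece and interior outside of it is degenerate. -/
lemma IsTreeGraded.eq_of_arc {X : Type*} [MetricSpace X] {PX : Set (Set X)}
    (hT : IsTreeGraded X PX) {P : Set X} (hP : P ∈ PX) {u v : X} (hu : u ∈ P) (hv : v ∈ P)
    (h : JoinedByArc (Pᶜ ∪ {u, v}) u v) : u = v := by
  by_contra huv
  obtain ⟨f, a, b, hab, hfc, hfi, hfa, hfb, hfS⟩ := h
  have hab' : a < b := hab.lt_of_ne fun h => huv (by rw [← hfa, ← hfb, h])
  obtain ⟨g, hg, hg0, hgD, hgP⟩ := hT.geodesicSub P hP v hv u hu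
  set D := dist v u
  have hD : 0 < D := dist_pos.2 (Ne.symm huv)
  have hint : ∀ t ∈ Ioo a b, f t ∉ P := by
    intro t ht htP
    rcases hfS t (Ioo_subset_Icc_self ht) with h | h | h
    · exact h htP
    · exact ht.1.ne' (hfi (Ioo_subset_Icc_self ht) (left_mem_Icc.2 hab) (h.trans hfa.symm))
    · exact ht.2.ne (hfi (Ioo_subset_Icc_self ht) (right_mem_Icc.2 hab)
        ((mem_singleton_iff.1 h).trans hfb.symm))
  obtain ⟨Q, hQ, hsub⟩ := hT.loop_subset_piece (h := gluePath f g b 0) (a := a)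
    (b := b + (D - 0)) (by linarith) (gluePath_continuousOn hfc hg.continuousOn (by rw [hfb, hg0]))
    (gluePath_injOn (I := Icc a b) (J := Ioo 0 D) hfi (hg.injOn.mono Ioo_subset_Icc_self) (by
      intro s hs t ht hst
      have ht' := Ioo_subset_Icc_self ht
      have hsP : f s ∈ P := by rw [hst]; exact hgP t ht'
      rcases hs.1.eq_or_lt with rfl | h1
      · exact ht.2.ne (hg.injOn ht' (right_mem_Icc.2 hD.le) (by rw [← hst, hfa, hgD]))
      · rcases hs.2.eq_or_lt with rfl | h2
        · exact ht.1.ne' (hg.injOn ht' (left_mem_Icc.2 hD.le) (by rw [← hst, hfb, hg0]))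
        · exact hint s ⟨h1, h2⟩ hsP)
      (fun t ht h => ⟨ht.1, h⟩) (fun t ht h => ⟨by linarith, by linarith [ht.2]⟩))
    (by
      rw [gluePath_of_le hab, gluePath_of_lt (by linarith), hfa, ← hgD]
      congr 1
      ring)
  have hfQ : ∀ t ∈ Icc a b, f t ∈ Q := fun t ht =>
    hsub ⟨t, ⟨ht.1, by linarith [ht.2]⟩, gluePath_of_le ht.2⟩
  have huQ : u ∈ Q := hfa ▸ hfQ a (left_mem_Icc.2 hab)
  have hvQ : v ∈ Q := hfb ▸ hfQ b (right_mem_Icc.2 hab)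
  by_cases hPQ : P = Q
  · subst hPQ
    exact hint ((a + b) / 2) ⟨by linarith, by linarith⟩
      (hfQ _ ⟨by linarith, by linarith⟩)
  · exact huv (hT.t1 P hP Q hQ hPQ ⟨hu, huQ⟩ ⟨hv, hvQ⟩)

lemma IsGeodesicSegment.exists_first {X : Type*} [MetricSpace X] {γ : ℝ → X} {a b : ℝ}
    (hγ : IsGeodesicSegment γ a b) {P : Set X} (hP : IsClosed P) {t : ℝ} (ht : t ∈ Icc a b)
    (htP : γ t ∈ P) :
    ∃ s ∈ Icc a b, γ s ∈ P ∧ ∀ t ∈ Icc a b, γ t ∈ P → s ≤ t := by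
  have hK : IsCompact (Icc a b ∩ γ ⁻¹' P) :=
    isCompact_Icc.of_isClosed_subset (hγ.continuousOn.preimage_isClosed_of_isClosed isClosed_Icc hP)
      inter_subset_left
  obtain ⟨s, ⟨hs, hsP⟩, hmin⟩ := hK.exists_isLeast ⟨t, ht, htP⟩
  exact ⟨s, hs, hsP, fun t ht htP => hmin ⟨ht, htP⟩⟩

lemma IsGeodesicSegment.exists_last {X : Type*} [MetricSpace X] {γ : ℝ → X} {a b : ℝ}
    (hγ : IsGeodesicSegment γ a b) {P : Set X} (hP : IsClosed P) {t : ℝ} (ht : t ∈ Icc a b)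
    (htP : γ t ∈ P) :
    ∃ s ∈ Icc a b, γ s ∈ P ∧ ∀ t ∈ Icc a b, γ t ∈ P → t ≤ s := by
  obtain ⟨s, hs, hsP, hmin⟩ := hγ.reverse.exists_first hP (t := -t)
    ⟨by linarith [ht.2], by linarith [ht.1]⟩ (by simpa using htP)
  refine ⟨-s, ⟨by linarith [hs.2], by linarith [hs.1]⟩, hsP, fun t ht htP => ?_⟩
  have := hmin (-t) ⟨by linarith [ht.2], by linarith [ht.1]⟩ (by simpa using htP)
  linarith

/-- Pieces are convex. -/
lemma IsTreeGraded.geodesic_mem {X : Type*} [MetricSpace X] {PX : Set (Set X)}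
    (hT : IsTreeGraded X PX) {P : Set X} (hP : P ∈ PX) {γ : ℝ → X} {a b : ℝ}
    (hγ : IsGeodesicSegment γ a b) (ha : γ a ∈ P) (hb : γ b ∈ P) {t : ℝ} (ht : t ∈ Icc a b) :
    γ t ∈ P := by
  by_contra htP
  have hcl := hT.closed P hP
  obtain ⟨s, hs, hsP, hsmax⟩ := (hγ.mono le_rfl ht.2).exists_last hcl (left_mem_Icc.2 ht.1) ha
  obtain ⟨s', hs', hsP', hsmin⟩ := (hγ.mono ht.1 le_rfl).exists_first hcl (right_mem_Icc.2 ht.2) hb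
  have hss : s ≤ s' := hs.2.trans hs'.1
  have heq := hT.eq_of_arc hP hsP hsP' ((hγ.mono hs.1 hs'.2).joinedByArc hss (by
    intro x hx
    by_cases hxP : γ x ∈ P
    · right
      rcases le_total x t with h | h
      · left
        rw [le_antisymm (hsmax x ⟨hs.1.trans hx.1, h⟩ hxP) hx.1]
      · right
        rw [mem_singleton_iff, le_antisymm hx.2 (hsmin x ⟨h, hx.2.trans hs'.2⟩ hxP)]
    · exact Or.inl hxP))
  have hse := hγ.injOn ⟨hs.1, hs.2.trans ht.2⟩ ⟨ht.1.trans hs'.1, hs'.2⟩ heq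
  have : t = s := le_antisymm (by linarith [hs'.1]) hs.2
  exact htP (this ▸ hsP)

namespace ColoringSetup

variable {X : Type*} [MetricSpace X] {PX : Set (Set X)} {n : ℕ} {r fr : ℝ} {xhat : X}
  {proj : Set X → X → X} {cP : Set X → X → Fin (n + 1)} {P : Set X}

lemma proj_of_mem (h : ColoringSetup X PX n r fr xhat proj cP) (hP : P ∈ PX) {x : X}
    (hx : x ∈ P) : proj P x = x := by
  have := h.projDist P hP x
  rw [infDist_zero_of_mem hx] at this
  exact (dist_eq_zero.1 this).symm

lemma joinedByArc_proj (h : ColoringSetup X PX n r fr xhat proj cP) (hP : P ∈ PX) (x : X) :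
    JoinedByArc (Pᶜ ∪ {proj P x}) (proj P x) x := by
  obtain ⟨γ, hγ, h0, hD⟩ := h.geodesic (proj P x) x
  have harc := hγ.joinedByArc (S := Pᶜ ∪ {proj P x}) dist_nonneg (by
    intro t ht
    by_cases htP : γ t ∈ P
    · right
      have h1 : dist (γ t) x = dist (proj P x) x - t := by
        have := hγ.dist_eq ht.1 ht.2 le_rfl
        rwa [hD] at this
      have h2 : dist (proj P x) x ≤ dist (γ t) x := by
        rw [dist_comm, h.projDist P hP x, dist_comm (γ t)]
        exact infDist_le_dist_of_mem htP
      have : t = 0 := le_antisymm (by linarith) ht.1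
      rw [this, h0]
      rfl
    · exact Or.inl htP)
  rwa [h0, hD] at harc

/-- A geodesic meeting a piece enters it at the projection of its initial point. -/
lemma exists_first_eq_proj (h : ColoringSetup X PX n r fr xhat proj cP) (hP : P ∈ PX)
    {γ : ℝ → X} {a b t : ℝ} (hγ : IsGeodesicSegment γ a b) (ht : t ∈ Icc a b) (htP : γ t ∈ P) :
    ∃ s ∈ Icc a b, γ s = proj P (γ a) ∧ ∀ t ∈ Icc a b, γ t ∈ P → s ≤ t := by
  obtain ⟨s, hs, hsP, hmin⟩ := hγ.exists_first (h.treeGraded.closed P hP) ht htP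
  refine ⟨s, hs, ?_, hmin⟩
  have h1 : JoinedByArc (Pᶜ ∪ {proj P (γ a), γ s}) (proj P (γ a)) (γ a) :=
    (h.joinedByArc_proj hP (γ a)).mono (union_subset_union_right _ (by simp))
  have h2 : JoinedByArc (Pᶜ ∪ {proj P (γ a), γ s}) (γ a) (γ s) :=
    (hγ.mono le_rfl hs.2).joinedByArc hs.1 (by
      intro x hx
      by_cases hxP : γ x ∈ P
      · right; right
        rw [mem_singleton_iff, le_antisymm hx.2 (hmin x ⟨hx.1, hx.2.trans hs.2⟩ hxP)]
      · exact Or.inl hxP)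
  exact (h.treeGraded.eq_of_arc hP (h.projMem P hP _) hsP (h1.trans h2)).symm

/-- A geodesic meeting a piece leaves it at the projection of its final point. -/
lemma exists_last_eq_proj (h : ColoringSetup X PX n r fr xhat proj cP) (hP : P ∈ PX)
    {γ : ℝ → X} {a b t : ℝ} (hγ : IsGeodesicSegment γ a b) (ht : t ∈ Icc a b) (htP : γ t ∈ P) :
    ∃ s ∈ Icc a b, γ s = proj P (γ b) ∧ ∀ t ∈ Icc a b, γ t ∈ P → t ≤ s := by
  obtain ⟨s, hs, hsP, hmin⟩ := h.exists_first_eq_proj hP hγ.reverse (t := -t)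
    ⟨by linarith [ht.2], by linarith [ht.1]⟩ (by simpa using htP)
  refine ⟨-s, ⟨by linarith [hs.2], by linarith [hs.1]⟩, by simpa using hsP, fun t ht htP => ?_⟩
  have := hmin (-t) ⟨by linarith [ht.2], by linarith [ht.1]⟩ (by simpa using htP)
  linarith

lemma proj_eq_of_geodesic_disjoint (h : ColoringSetup X PX n r fr xhat proj cP) (hP : P ∈ PX)
    {γ : ℝ → X} {a b : ℝ} (hab : a ≤ b) (hγ : IsGeodesicSegment γ a b)
    (hdisj : ∀ t ∈ Icc a b, γ t ∉ P) : proj P (γ a) = proj P (γ b) := by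
  have h1 : JoinedByArc (Pᶜ ∪ {proj P (γ a), proj P (γ b)}) (proj P (γ a)) (γ a) :=
    (h.joinedByArc_proj hP (γ a)).mono (union_subset_union_right _ (by simp))
  have h2 : JoinedByArc (Pᶜ ∪ {proj P (γ a), proj P (γ b)}) (γ a) (γ b) :=
    hγ.joinedByArc hab fun t ht => Or.inl (hdisj t ht)
  have h3 : JoinedByArc (Pᶜ ∪ {proj P (γ a), proj P (γ b)}) (γ b) (proj P (γ b)) :=
    ((h.joinedByArc_proj hP (γ b)).mono (union_subset_union_right _ (by simp))).symm
  exact h.treeGraded.eq_of_arc hP (h.projMem P hP _) (h.projMem P hP _) ((h1.trans h2).trans h3)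

lemma dist_proj_add_le (h : ColoringSetup X PX n r fr xhat proj cP) (hP : P ∈ PX) {x y : X}
    (hxy : proj P x ≠ proj P y) :
    dist (proj P x) (proj P y) + dist (proj P y) y ≤ dist x y := by
  obtain ⟨γ, hγ, h0, hD⟩ := h.geodesic x y
  by_cases hmeet : ∃ t ∈ Icc 0 (dist x y), γ t ∈ P
  · obtain ⟨t, ht, htP⟩ := hmeet
    obtain ⟨s, hs, hsP, hmin⟩ := h.exists_first_eq_proj hP hγ ht htP
    obtain ⟨s', hs', hsP', -⟩ := h.exists_last_eq_proj hP hγ ht htP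
    have hss : s ≤ s' := hmin s' hs' (hsP' ▸ h.projMem P hP _)
    have h1 := hγ.dist_eq hs.1 hss hs'.2
    have h2 := hγ.dist_eq hs'.1 hs'.2 le_rfl
    rw [hsP, hsP', h0, hD] at h1
    rw [hsP', hD] at h2
    linarith [hs.1]
  · push Not at hmeet
    have := h.proj_eq_of_geodesic_disjoint hP dist_nonneg hγ hmeet
    rw [h0, hD] at this
    exact absurd this hxy

lemma color_eq_zero_of_mem_pieceComp {y : X} (hy : y ∈ pieceComp r xhat proj cP P) :
    cP P y = 0 := by
  obtain ⟨m, c, -, hm, hc, -⟩ := hy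
  exact hm ▸ (hc m le_rfl).2

lemma mem_pieceComp_of_dist_le (h : ColoringSetup X PX n r fr xhat proj cP) (hP : P ∈ PX)
    {y : X} (hy : y ∈ P) (hd : dist (proj P xhat) y ≤ 2 * r) :
    y ∈ pieceComp r xhat proj cP P := by
  obtain ⟨g, hg, hg0, hgD, hgP⟩ := h.treeGraded.geodesicSub P hP _ (h.projMem P hP xhat) y hy
  set D := dist (proj P xhat) y
  have hD : 0 ≤ D := dist_nonneg
  have hr := h.rpos
  have hmem : ∀ i ≤ 3, (i : ℕ) * (D / 3) ∈ Icc 0 D := by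
    intro i hi
    have : (i : ℝ) ≤ 3 := by exact_mod_cast hi
    exact ⟨by positivity, by nlinarith⟩
  refine ⟨3, fun i => g (i * (D / 3)), by simpa using hg0, ?_, ?_, ?_⟩
  · simpa [mul_div_cancel₀] using hgD
  · intro i hi
    have ht := hmem i hi
    refine ⟨hgP _ ht, h.ballZero P hP _ (hgP _ ht) ?_⟩
    have := hg.dist_eq le_rfl ht.1 ht.2
    rw [hg0, dist_comm] at this
    rw [this]
    linarith [ht.2]
  · intro i hi
    have h1 := hmem i hi.le
    have h2 := hmem (i + 1) hi
    rw [hg _ h1 _ h2]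
    push_cast
    rw [show (i : ℝ) * (D / 3) - (i + 1) * (D / 3) = -(D / 3) by ring, abs_neg,
      abs_of_nonneg (by positivity)]
    linarith

/-- If the last part of a geodesic from `x̂`, after it leaves the piece `P`, has length at most
`2r`, then every piece met by this part projects both of its endpoints to the zero-colored
component of its base point, and any other piece has the same projection of both endpoints. -/
lemma tail_dichotomy (h : ColoringSetup X PX n r fr xhat proj cP) (hP : P ∈ PX) {γ : ℝ → X}
    {S T L : ℝ} (hγ : IsGeodesicSegment γ 0 L) (hγ0 : γ 0 = xhat) (hS : 0 ≤ S) (hST : S < T)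
    (hTL : T ≤ L) (hL : L - T ≤ 2 * r) (hSP : γ S ∈ P) (hTP : γ T ∈ P)
    (hlast : ∀ t ∈ Icc 0 L, γ t ∈ P → t ≤ T) {Q : Set X} (hQ : Q ∈ PX) :
    ((∀ t ∈ Icc 0 L, γ t ∈ Q → t ≤ T) ∧ proj Q (γ L) = proj Q (γ T)) ∨
      (proj Q (γ L) ∈ pieceComp r xhat proj cP Q ∧ proj Q (γ T) ∈ pieceComp r xhat proj cP Q) := by
  have hT0 : 0 ≤ T := hS.trans hST.le
  have htail : IsGeodesicSegment γ T L := hγ.mono hT0 le_rfl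
  by_cases hmeet : ∀ t ∈ Icc 0 L, γ t ∈ Q → t ≤ T
  · refine Or.inl ⟨hmeet, ?_⟩
    by_cases hTQ : γ T ∈ Q
    · obtain ⟨s, hs, hsQ, -⟩ := h.exists_last_eq_proj hQ htail (left_mem_Icc.2 hTL) hTQ
      have hsT : s = T := le_antisymm
        (hmeet s ⟨hT0.trans hs.1, hs.2⟩ (hsQ ▸ h.projMem Q hQ _)) hs.1
      rw [← hsQ, hsT, h.proj_of_mem hQ hTQ]
    · refine (h.proj_eq_of_geodesic_disjoint hQ hTL htail fun t ht htQ => hTQ ?_).symm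
      rwa [le_antisymm ht.1 (hmeet t ⟨hT0.trans ht.1, ht.2⟩ htQ)]
  · push Not at hmeet
    obtain ⟨t, ht, htQ, hTt⟩ := hmeet
    right
    have hPQ : P ≠ Q := by
      rintro rfl
      exact absurd (hlast t ht htQ) (not_le.2 hTt)
    have hbefore : ∀ s ∈ Icc 0 L, γ s ∈ Q → T ≤ s := by
      intro s hs hsQ
      by_contra! hsT
      have hM : max S s ∈ Icc S T := ⟨le_max_left _ _, max_le hST.le hsT.le⟩
      have hPM : γ (max S s) ∈ P :=
        h.treeGraded.geodesic_mem hP (hγ.mono hS hTL) hSP hTP hM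
      have hconv := hγ.mono hs.1 ht.2
      have hQM : γ (max S s) ∈ Q :=
        h.treeGraded.geodesic_mem hQ hconv hsQ htQ ⟨le_max_right _ _, hM.2.trans hTt.le⟩
      have hQT : γ T ∈ Q := h.treeGraded.geodesic_mem hQ hconv hsQ htQ ⟨hsT.le, hTt.le⟩
      have := hγ.injOn ⟨hS.trans hM.1, hM.2.trans hTL⟩ ⟨hT0, hTL⟩
        (h.treeGraded.t1 P hP Q hQ hPQ ⟨hPM, hQM⟩ ⟨hTP, hQT⟩)
      exact (max_lt hST hsT).ne this
    have htT : t ∈ Icc T L := ⟨hTt.le, ht.2⟩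
    obtain ⟨s₀, hs₀, hs₀Q, hmin₀⟩ := h.exists_first_eq_proj hQ hγ ht htQ
    obtain ⟨s₁, hs₁, hs₁Q, hmin₁⟩ := h.exists_first_eq_proj hQ htail htT htQ
    obtain ⟨s₂, hs₂, hs₂Q, hmax₂⟩ := h.exists_last_eq_proj hQ htail htT htQ
    have m₀ : γ s₀ ∈ Q := hs₀Q ▸ h.projMem Q hQ _
    have m₁ : γ s₁ ∈ Q := hs₁Q ▸ h.projMem Q hQ _
    have m₂ : γ s₂ ∈ Q := hs₂Q ▸ h.projMem Q hQ _
    have hT₀ : T ≤ s₀ := hbefore s₀ hs₀ m₀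
    rw [hγ0] at hs₀Q
    have key : ∀ s ∈ Icc T L, γ s ∈ Q → γ s ∈ pieceComp r xhat proj cP Q := by
      intro s hs hsQ
      refine h.mem_pieceComp_of_dist_le hQ hsQ ?_
      rw [← hs₀Q, hγ.dist_eq hs₀.1 (hmin₀ s ⟨hT0.trans hs.1, hs.2⟩ hsQ) hs.2]
      linarith [hs.2]
    exact ⟨hs₂Q ▸ key s₂ hs₂ m₂, hs₁Q ▸ key s₁ hs₁ m₁⟩

end ColoringSetup

/-- The endpoint pairs of the maximal closed intervals contained in `A`. -/
def maximalIntervals (A : Set ℝ) : Set (ℝ × ℝ) :=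
  {p | p.1 ≤ p.2 ∧ Icc p.1 p.2 ⊆ A ∧
    ∀ a b, a ≤ p.1 → p.2 ≤ b → Icc a b ⊆ A → a = p.1 ∧ b = p.2}

lemma Icc_subset_of_subset_iUnion {k : ℕ} {a b : Fin k → ℝ}
    (hdisj : ∀ i j, i ≠ j → b i < a j ∨ b j < a i) {i : Fin k} {u v w : ℝ}
    (hsub : Icc u v ⊆ ⋃ i, Icc (a i) (b i)) (hw : w ∈ Icc u v) (hwi : w ∈ Icc (a i) (b i)) :
    Icc u v ⊆ Icc (a i) (b i) := by
  have hij : ∀ j ≠ i, ∀ x ∈ Icc (a i) (b i), x ∉ Icc (a j) (b j) := by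
    intro j hj x hx hx'
    rcases hdisj i j hj.symm with h | h
    · linarith [hx.2, hx'.1]
    · linarith [hx.1, hx'.2]
  have hcl : IsClosed (⋃ j ∈ {j | j ≠ i}, Icc (a j) (b j)) :=
    (toFinite {j | j ≠ i}).isClosed_biUnion fun j _ => isClosed_Icc
  have hsub' : Icc u v ⊆ Icc (a i) (b i) ∪ ⋃ j ∈ {j | j ≠ i}, Icc (a j) (b j) := by
    intro x hx
    obtain ⟨j, hj⟩ := mem_iUnion.1 (hsub hx)
    by_cases hji : j = i
    · exact Or.inl (hji ▸ hj)
    · exact Or.inr (mem_biUnion (s := {j | j ≠ i}) hji hj)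
  rcases isPreconnected_iff_subset_of_disjoint_closed.1 isPreconnected_Icc _ _ isClosed_Icc hcl
    hsub' (by
      rw [eq_empty_iff_forall_notMem]
      rintro x ⟨-, hx, hx'⟩
      obtain ⟨j, hj, hxj⟩ := mem_iUnion₂.1 hx'
      exact hij j hj x hx hxj) with h | h
  · exact h
  · obtain ⟨j, hj, hwj⟩ := mem_iUnion₂.1 (h hw)
    exact absurd hwj (hij j hj w hwi)

lemma range_eq_maximalIntervals {k : ℕ} {a b : Fin k → ℝ} (hab : ∀ i, a i ≤ b i)
    (hdisj : ∀ i j, i ≠ j → b i < a j ∨ b j < a i) :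
    range (fun i => (a i, b i)) = maximalIntervals (⋃ i, Icc (a i) (b i)) := by
  ext ⟨u, v⟩
  constructor
  · rintro ⟨i, hi⟩
    obtain ⟨rfl, rfl⟩ := Prod.mk.inj hi
    refine ⟨hab i, subset_iUnion (fun i => Icc (a i) (b i)) i, fun u v hu hv huv => ?_⟩
    have huv' : u ≤ v := hu.trans ((hab i).trans hv)
    have hsub := Icc_subset_of_subset_iUnion hdisj huv (w := a i) ⟨hu, (hab i).trans hv⟩
      (left_mem_Icc.2 (hab i))
    exact ⟨le_antisymm hu (hsub (left_mem_Icc.2 huv')).1,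
      le_antisymm (hsub (right_mem_Icc.2 huv')).2 hv⟩
  · rintro ⟨huv, hsub, hmax⟩
    obtain ⟨i, hi⟩ := mem_iUnion.1 (hsub (left_mem_Icc.2 huv))
    have hsub' := Icc_subset_of_subset_iUnion hdisj hsub (left_mem_Icc.2 huv) hi
    obtain ⟨h1, h2⟩ := hmax (a i) (b i) (hsub' (left_mem_Icc.2 huv)).1
      (hsub' (right_mem_Icc.2 huv)).2 (subset_iUnion (fun i => Icc (a i) (b i)) i)
    exact ⟨i, Prod.ext h1 h2⟩

lemma sum_eq_finsum_maximalIntervals {k : ℕ} {a b : Fin k → ℝ} (hab : ∀ i, a i ≤ b i)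
    (hdisj : ∀ i j, i ≠ j → b i < a j ∨ b j < a i) (F : ℝ → ℝ → ℕ) :
    ∑ i, F (a i) (b i) =
      ∑ᶠ p ∈ maximalIntervals (⋃ i, Icc (a i) (b i)), F p.1 p.2 := by
  have hinj : Function.Injective (fun i => (a i, b i)) := by
    intro i j hij
    obtain ⟨h1, h2⟩ := Prod.mk.inj hij
    by_contra hne
    rcases hdisj i j hne with h | h
    · linarith [hab i]
    · linarith [hab i]
  rw [← range_eq_maximalIntervals hab hdisj, finsum_mem_range hinj, finsum_eq_sum_of_fintype]

/-- The maximal intervals of `A` and of `A ∩ Iic T` agree except for those that start at `T` or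
later, if `T` is the upper end of a gap of `A`. -/
lemma finsum_maximalIntervals_eq {A B : Set ℝ} {R T : ℝ} (hRT : R < T)
    (hgap : ∀ t ∈ Ioo R T, t ∉ A) (hBA : ∀ t, t ∈ B ↔ t ∈ A ∧ t ≤ T) {F : ℝ × ℝ → ℕ}
    (hF : ∀ u v, T ≤ u → u ≤ v → Icc u v ⊆ A → F (u, v) = 0) :
    ∑ᶠ p ∈ maximalIntervals A, F p = ∑ᶠ p ∈ maximalIntervals B, F p := by
  have hstart : ∀ u v, u ≤ v → T ≤ v → Icc u v ⊆ A → T ≤ u := by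
    intro u v huv hTv hsub
    by_contra! huT
    obtain ⟨t, ht, htT⟩ := exists_between (max_lt hRT huT)
    exact hgap t ⟨(le_max_left _ _).trans_lt ht, htT⟩
      (hsub ⟨((le_max_right _ _).trans_lt ht).le, htT.le.trans hTv⟩)
  have hBA' : B ⊆ A := fun t ht => ((hBA t).1 ht).1
  refine finsum_mem_inter_support_eq _ _ _ ?_
  ext ⟨u, v⟩
  constructor
  · rintro ⟨⟨huv, hsub, hmax⟩, hFp⟩
    have hvT : v ≤ T := by
      by_contra! hTv
      exact hFp (hF u v (hstart u v huv hTv.le hsub) huv hsub)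
    exact ⟨⟨huv, fun t ht => (hBA t).2 ⟨hsub ht, ht.2.trans hvT⟩,
      fun a b ha hb hab => hmax a b ha hb (hab.trans hBA')⟩, hFp⟩
  · rintro ⟨⟨huv, hsub, hmax⟩, hFp⟩
    refine ⟨⟨huv, hsub.trans hBA', fun a b ha hb hab => ?_⟩, hFp⟩
    refine hmax a b ha hb fun t ht => (hBA t).2 ⟨hab ht, ht.2.trans ?_⟩
    by_contra! hTb
    have hTa := hstart a b (ha.trans (huv.trans hb)) hTb.le hab
    exact hFp (hF u v (hTa.trans ha) huv (hsub.trans hBA'))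

lemma floor_floorLen_eq_zero {X : Type*} [MetricSpace X] {PX : Set (Set X)}
    (hT : IsTreeGraded X PX) {γ : ℝ → X} {a b M : ℝ} (hM : 0 < M) (hab : a ≤ b)
    (hlen : b - a < M) : ⌊floorLen PX γ a b / M⌋₊ = 0 := by
  rw [Nat.floor_eq_zero, div_lt_one hM]
  refine lt_of_le_of_lt ?_ hlen
  unfold floorLen
  gcongr
  refine csInf_le ⟨a, fun t ht => ht.1.1⟩ ⟨right_mem_Icc.2 hab, ?_⟩
  obtain ⟨P, hP, hbP⟩ := hT.covers (γ b)
  exact ⟨P, hP, by simpa using hbP⟩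

namespace ColoringSetup

variable {X : Type*} [MetricSpace X] {PX : Set (Set X)} {n : ℕ} {r fr : ℝ} {xhat : X}
  {proj : Set X → X → X} {cP : Set X → X → Fin (n + 1)} {P : Set X}

/-- Cutting a geodesic from `x̂` at its exit point from a long piece, at distance less than `r`
from its endpoint, does not change the color value. -/
lemma colorValue_eq_of_tail (h : ColoringSetup X PX n r fr xhat proj cP) (hP : P ∈ PX)
    {γ : ℝ → X} {S T L : ℝ} (hγ : IsGeodesicSegment γ 0 L) (hγ0 : γ 0 = xhat)
    (hS : S ∈ Icc 0 L) (hT : T ∈ Icc 0 L) (hL : L - T < r) (hxP : γ S = proj P xhat)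
    (hTP : γ T = proj P (γ L))
    (hfirst : ∀ t ∈ Icc 0 L, γ t ∈ P → S ≤ t) (hlast : ∀ t ∈ Icc 0 L, γ t ∈ P → t ≤ T)
    (hnot : γ T ∉ pieceComp r xhat proj cP P) {v w : Fin (n + 1)}
    (hv : ColorValue PX r fr xhat proj cP γ L v) (hw : ColorValue PX r fr xhat proj cP γ T w) :
    v = w := by
  have hr := h.rpos
  have hfr := h.rlefr
  have mS : γ S ∈ P := hxP ▸ h.projMem P hP _
  have mT : γ T ∈ P := hTP ▸ h.projMem P hP _
  have hST : S ≤ T := hfirst T hT mT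
  have hfar : 2 * r < T - S := by
    by_contra! hcon
    refine hnot (h.mem_pieceComp_of_dist_le hP mT ?_)
    rwa [← hxP, hγ.dist_eq hS.1 hST hT.2]
  have hdich := fun {Q : Set X} (hQ : Q ∈ PX) => h.tail_dichotomy hP hγ hγ0 hS.1
    (by linarith : S < T) hT.2 (by linarith) mS mT hlast hQ
  have hcolor : ∀ Q ∈ PX, cP Q (proj Q (γ L)) = cP Q (proj Q (γ T)) := by
    intro Q hQ
    rcases hdich hQ with ⟨-, hp⟩ | ⟨hp, hp'⟩
    · rw [hp]
    · rw [color_eq_zero_of_mem_pieceComp hp, color_eq_zero_of_mem_pieceComp hp']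
  have hle : ∀ Q, IsLongPiece PX r xhat proj cP γ L Q → ∀ t ∈ Icc 0 L, γ t ∈ Q → t ≤ T := by
    rintro Q ⟨hQ, -, hn⟩
    rcases hdich hQ with ⟨hp, -⟩ | ⟨hp, -⟩
    · exact hp
    · exact absurd hp hn
  have hlong : ∀ Q, IsLongPiece PX r xhat proj cP γ L Q ↔
      IsLongPiece PX r xhat proj cP γ T Q := by
    intro Q
    constructor
    · intro hlQ
      obtain ⟨hQ, ⟨t, ht, htQ⟩, hn⟩ := id hlQ
      refine ⟨hQ, ⟨t, ⟨ht.1, hle Q hlQ t ht htQ⟩, htQ⟩, ?_⟩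
      rcases hdich hQ with ⟨-, hp⟩ | ⟨hp, -⟩
      · rwa [← hp]
      · exact absurd hp hn
    · rintro ⟨hQ, ⟨t, ht, htQ⟩, hn⟩
      refine ⟨hQ, ⟨t, ⟨ht.1, ht.2.trans hT.2⟩, htQ⟩, ?_⟩
      rcases hdich hQ with ⟨-, hp⟩ | ⟨-, hp⟩
      · rwa [hp]
      · exact absurd hp hn
  have hset : ∀ Q, IsLongPiece PX r xhat proj cP γ L Q →
      {t | t ∈ Icc 0 L ∧ γ t ∈ Q} = {t | t ∈ Icc 0 T ∧ γ t ∈ Q} := by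
    intro Q hlQ
    ext t
    exact ⟨fun ht => ⟨⟨ht.1.1, hle Q hlQ t ht.1 ht.2⟩, ht.2⟩,
      fun ht => ⟨⟨ht.1.1, ht.1.2.trans hT.2⟩, ht.2⟩⟩
  have hPlong : IsLongPiece PX r xhat proj cP γ L P := ⟨hP, ⟨T, hT, mT⟩, hTP ▸ hnot⟩
  have hPstart : pieceStart γ L P = S :=
    IsLeast.csInf_eq ⟨⟨hS, mS⟩, fun t ht => hfirst t ht.1 ht.2⟩
  have hPend : pieceEnd γ L P = T :=
    IsGreatest.csSup_eq ⟨⟨hT, mT⟩, fun t ht => hlast t ht.1 ht.2⟩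
  have hgap : ∀ t ∈ Ioo (S + r / 2) T, t ∉ betaSet PX r xhat proj cP γ L := by
    rintro t ht ⟨-, hn⟩
    exact hn (mem_biUnion (show P ∈ {P | _} from hPlong) (by rwa [hPstart, hPend]))
  have hbeta : ∀ t, t ∈ betaSet PX r xhat proj cP γ T ↔
      t ∈ betaSet PX r xhat proj cP γ L ∧ t ≤ T := by
    intro t
    have hunion : (⋃ Q ∈ {Q | IsLongPiece PX r xhat proj cP γ T Q},
        Ioo (pieceStart γ T Q + r / 2) (pieceEnd γ T Q)) =
        ⋃ Q ∈ {Q | IsLongPiece PX r xhat proj cP γ L Q},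
        Ioo (pieceStart γ L Q + r / 2) (pieceEnd γ L Q) := by
      have : {Q | IsLongPiece PX r xhat proj cP γ T Q} =
          {Q | IsLongPiece PX r xhat proj cP γ L Q} := by
        ext Q
        exact (hlong Q).symm
      rw [this]
      refine iUnion₂_congr fun Q hQ => ?_
      rw [pieceStart, pieceStart, pieceEnd, pieceEnd, hset Q hQ]
    rw [betaSet, betaSet, hunion]
    constructor
    · rintro ⟨ht, hn⟩
      exact ⟨⟨⟨ht.1, ht.2.trans hT.2⟩, hn⟩, ht.2⟩
    · rintro ⟨⟨ht, hn⟩, htT⟩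
      exact ⟨⟨ht.1, htT⟩, hn⟩
  obtain ⟨Ps, k, a, b, hPs, hab, hAB, hdisj, hv⟩ := hv
  obtain ⟨Ps', k', a', b', hPs', hab', hAB', hdisj', hw⟩ := hw
  have hPsEq : Ps = Ps' := by
    rw [← Finset.coe_inj, hPs, hPs']
    ext Q
    exact and_congr_right fun hQ => by rw [hcolor Q hQ]
  have hsum : ∑ Q ∈ Ps, (cP Q (proj Q (γ L)) : ℕ) = ∑ Q ∈ Ps', (cP Q (proj Q (γ T)) : ℕ) := by
    rw [← hPsEq]
    refine Finset.sum_congr rfl fun Q hQ => ?_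
    have hQ' : Q ∈ (Ps : Set (Set X)) := hQ
    rw [hPs] at hQ'
    rw [hcolor Q hQ'.1]
  have hfloor := finsum_maximalIntervals_eq (by linarith : S + r / 2 < T) hgap hbeta
    (F := fun p => ⌊floorLen PX γ p.1 p.2 / (99 * fr)⌋₊) (by
      intro u v hTu huv hsub
      have hvL : v ≤ L := (hsub (right_mem_Icc.2 huv)).1.2
      exact floor_floorLen_eq_zero h.treeGraded (by linarith) huv (by linarith))
  rw [hAB, hAB', ← sum_eq_finsum_maximalIntervals hab hdisj
      (fun u v => ⌊floorLen PX γ u v / (99 * fr)⌋₊),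
    ← sum_eq_finsum_maximalIntervals hab' hdisj'
      (fun u v => ⌊floorLen PX γ u v / (99 * fr)⌋₊)] at hfloor
  rw [Fin.ext_iff, hv, hw, hsum, hfloor]

/-- A point at distance less than `r` from a piece `P` whose projection to `P` is not in `𝔠_P`
has the same color as this projection. -/
lemma color_eq_color_proj (h : ColoringSetup X PX n r fr xhat proj cP) {cX : X → Fin (n + 1)}
    (hcX : ∀ (γ : ℝ → X) (L : ℝ), 0 ≤ L → IsGeodesicSegment γ 0 L → γ 0 = xhat →
      ColorValue PX r fr xhat proj cP γ L (cX (γ L)))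
    (hP : P ∈ PX) {z : X} (hz : dist (proj P z) z < r)
    (hnot : proj P z ∉ pieceComp r xhat proj cP P) : cX z = cX (proj P z) := by
  obtain ⟨γ, hγ, h0, hD⟩ := h.geodesic xhat z
  have hmeet : ∃ t ∈ Icc 0 (dist xhat z), γ t ∈ P := by
    by_contra! hcon
    have := h.proj_eq_of_geodesic_disjoint hP dist_nonneg hγ hcon
    rw [h0, hD] at this
    refine hnot (h.mem_pieceComp_of_dist_le hP (h.projMem P hP z) ?_)
    rw [this, dist_self]
    linarith [h.rpos]
  obtain ⟨t, ht, htP⟩ := hmeet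
  obtain ⟨S, hS, hSP, hfirst⟩ := h.exists_first_eq_proj hP hγ ht htP
  obtain ⟨T, hT, hTP, hlast⟩ := h.exists_last_eq_proj hP hγ ht htP
  have hTD := hγ.dist_eq hT.1 hT.2 le_rfl
  have hTP' := hTP
  rw [hD] at hTP' hTD
  rw [hTP'] at hTD
  rw [h0] at hSP
  have hvL := hcX γ _ dist_nonneg hγ h0
  have hvT := hcX γ T hT.1 (hγ.mono le_rfl hT.2) h0
  have := h.colorValue_eq_of_tail hP hγ h0 hS hT (by linarith) hSP hTP hfirst hlast
    (by rwa [hTP']) hvL hvT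
  rwa [hD, hTP'] at this

end ColoringSetup

/-- In the Setup, if an `r`-chain of points of the same `c*_X`-color `𝔠` connects two
points `x` and `y` of a piece `P`, and none of the projections of the chain points to
`P` belongs to `𝔠_P`, then the projected chain is an `r`-chain of points of `c*_X`-color
`𝔠` connecting `x` and `y` inside `P`. -/
theorem projected_chain_same_color (X : Type*) [MetricSpace X] [CompleteSpace X]
    (PX : Set (Set X)) (n : ℕ) (r fr : ℝ) (xhat : X)
    (proj : Set X → X → X) (cP : Set X → X → Fin (n + 1))
    (hsetup : ColoringSetup X PX n r fr xhat proj cP)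
    (cX : X → Fin (n + 1))
    (hcX : ∀ (γ : ℝ → X) (L : ℝ), 0 ≤ L → IsGeodesicSegment γ 0 L → γ 0 = xhat →
      ColorValue PX r fr xhat proj cP γ L (cX (γ L)))
    (P : Set X) (hP : P ∈ PX) (x y : X) (hx : x ∈ P) (hy : y ∈ P)
    (co : Fin (n + 1)) (m : ℕ) (c : ℕ → X)
    (hc0 : c 0 = x) (hcm : c m = y)
    (hcolor : ∀ i ≤ m, cX (c i) = co)
    (hstep : ∀ i < m, dist (c i) (c (i + 1)) < r)
    (hnotin : ∀ i ≤ m, proj P (c i) ∉ pieceComp r xhat proj cP P) :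
    proj P (c 0) = x ∧ proj P (c m) = y ∧
    (∀ i ≤ m, proj P (c i) ∈ P ∧ cX (proj P (c i)) = co) ∧
    ∀ i < m, dist (proj P (c i)) (proj P (c (i + 1))) < r := by
  subst hc0 hcm
  have hstep_proj : ∀ i < m, proj P (c i) ≠ proj P (c (i + 1)) →
      dist (proj P (c i)) (proj P (c (i + 1))) < r ∧
        dist (proj P (c (i + 1))) (c (i + 1)) < r := by
    intro i hi hne
    have h1 := hsetup.dist_proj_add_le hP hne
    have h2 := hstep i hi
    have h3 : 0 ≤ dist (proj P (c i)) (proj P (c (i + 1))) := dist_nonneg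
    have h4 : 0 ≤ dist (proj P (c (i + 1))) (c (i + 1)) := dist_nonneg
    exact ⟨by linarith, by linarith⟩
  have hcol : ∀ i ≤ m, cX (proj P (c i)) = co := by
    intro i
    induction i with
    | zero =>
      intro hi
      rw [hsetup.proj_of_mem hP hx]
      exact hcolor 0 hi
    | succ i ih =>
      intro hi
      by_cases hne : proj P (c i) = proj P (c (i + 1))
      · rw [← hne]
        exact ih (by omega)
      · rw [← hsetup.color_eq_color_proj hcX hP (hstep_proj i hi hne).2 (hnotin _ hi)]
        exact hcolor _ hi
  refine ⟨hsetup.proj_of_mem hP hx, hsetup.proj_of_mem hP hy,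
    fun i hi => ⟨hsetup.projMem P hP _, hcol i hi⟩, fun i hi => ?_⟩
  by_cases hne : proj P (c i) = proj P (c (i + 1))
  · rw [hne, dist_self]
    exact hsetup.rpos
  · exact (hstep_proj i hi hne).1
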